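/- For every B ∈ ℕ, an FO sentence φ over a finite vocabulary is in PSC(B) if and only if φ is logically equivalent to a sentence of the form ∃x₁…∃x_B ∀y₁…∀y_n β where β is quantifier-free (a Σ⁰₂ sentence with exactly B existential quantifiers). -/

import Mathlib

open FirstOrder Language

universe u v

namespace Stmt

variable {L : FirstOrder.Language.{u, v}}

/-- Universally quantify the last `k` bound variables of a bounded formula. -/
def allsK {n : ℕ} : (k : ℕ) → L.BoundedFormula Empty (n + k) → L.BoundedFormula Empty n
  | 0, φ => φ
  | k + 1, φ => allsK k φ.all

/-- Existentially quantify the last `k` bound variables of a bounded formula. -/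
def exsK {n : ℕ} : (k : ℕ) → L.BoundedFormula Empty (n + k) → L.BoundedFormula Empty n
  | 0, φ => φ
  | k + 1, φ => exsK k φ.ex

/-- The Σ⁰₂ sentence `∃x₁…x_B ∀y₁…y_n β` (for `β` quantifier-free). -/
def sigma2 (B n : ℕ) (β : L.BoundedFormula Empty (B + n)) : L.Sentence :=
  (allsK n β).exs

/-- The Π⁰₂ sentence `∀x₁…x_k ∃y₁…y_m β` (for `β` quantifier-free). -/
def pi2 (k m : ℕ) (β : L.BoundedFormula Empty (k + m)) : L.Sentence :=
  (exsK m β).alls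

/-- `C` is a core of the structure `M` w.r.t. `φ`: every (nonempty) substructure of `M`
whose universe contains `C` satisfies `φ`. -/
def IsCore (φ : L.Sentence) (M : Type max u v) [L.Structure M] (C : Set M) : Prop :=
  ∀ N : L.Substructure M, C ⊆ (N : Set M) → Nonempty N → ↥N ⊨ φ

/-- `φ` is preserved under substructures modulo a finite core: every model of `φ`
has a finite core w.r.t. `φ`. -/
def PSCf (φ : L.Sentence) : Prop :=
  ∀ (M : Type max u v) [L.Structure M] [Nonempty M],
    M ⊨ φ → ∃ C : Set M, C.Finite ∧ IsCore φ M C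

/-- `φ ∈ PSC(B)`: every model of `φ` has a core of size at most `B` w.r.t. `φ`. -/
def PSC (φ : L.Sentence) (B : ℕ) : Prop :=
  ∀ (M : Type max u v) [L.Structure M] [Nonempty M],
    M ⊨ φ → ∃ C : Finset M, C.card ≤ B ∧ IsCore φ M ↑C

/-- Logical equivalence of sentences: they hold in exactly the same (nonempty) structures. -/
def Equiv (φ ψ : L.Sentence) : Prop :=
  ∀ (M : Type max u v) [L.Structure M] [Nonempty M], M ⊨ φ ↔ M ⊨ ψ


section Helpers

theorem realize_allsK {M : Type*} [L.Structure M] {m : ℕ} (k : ℕ)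
    (φ : L.BoundedFormula Empty (m + k)) (v : Empty → M) (x : Fin m → M) :
    (allsK k φ).Realize v x ↔ ∀ y : Fin k → M, φ.Realize v (Fin.append x y) := by
  induction k with
  | zero =>
    simp only [allsK]
    constructor
    · intro h y
      have : Fin.append x y = x := by
        rw [Subsingleton.elim y Fin.elim0]; exact Fin.append_elim0 x
      rwa [this]
    · intro h
      have := h Fin.elim0
      rwa [show Fin.append x Fin.elim0 = x from Fin.append_elim0 x] at this
  | succ k ih =>
    simp only [allsK]
    rw [ih]
    simp only [BoundedFormula.realize_all]
    constructor
    · intro h y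
      have := h (Fin.init y) (y (Fin.last k))
      rw [← Fin.append_snoc] at this
      rwa [Fin.snoc_init_self] at this
    · intro h y a
      have := h (Fin.snoc y a)
      rwa [Fin.append_snoc] at this

theorem realize_sigma2 {M : Type*} [L.Structure M] (B n : ℕ)
    (β : L.BoundedFormula Empty (B + n)) :
    M ⊨ sigma2 B n β ↔
      ∃ x : Fin B → M, ∀ y : Fin n → M, β.Realize default (Fin.append x y) := by
  unfold sigma2 Sentence.Realize
  rw [BoundedFormula.realize_exs]
  simp only [realize_allsK]

def AllF {B : ℕ} (θ : L.Formula (Fin B ⊕ ℕ)) (M : Type*) [L.Structure M] (x : Fin B → M) : Prop :=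
  ∀ y : ℕ → M, θ.Realize (Sum.elim x y)

theorem realize_congr_free {α M : Type*} [L.Structure M] [DecidableEq α] (θ : L.Formula α)
    (v w : α → M) (h : ∀ a ∈ BoundedFormula.freeVarFinset θ, v a = w a) :
    θ.Realize v ↔ θ.Realize w := by
  have h1 := BoundedFormula.realize_restrictFreeVar (φ := θ) (f := id) (v := fun a => v a)
    (xs := (default : Fin 0 → M)) v (fun a => rfl)
  have h2 := BoundedFormula.realize_restrictFreeVar (φ := θ) (f := id) (v := fun a => v a)
    (xs := (default : Fin 0 → M)) w (fun a => h a a.2)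
  exact h1.symm.trans h2

theorem exists_sigma2 {B : ℕ} (θ : L.Formula (Fin B ⊕ ℕ)) (hθ : θ.IsQF) :
    ∃ (n : ℕ) (β : L.BoundedFormula Empty (B + n)), β.IsQF ∧
      ∀ (M : Type max u v) [L.Structure M],
        M ⊨ sigma2 B n β ↔ ∃ x : Fin B → M, AllF θ M x := by
  classical
  obtain ⟨n, hn⟩ : ∃ n : ℕ, ∀ j, Sum.inr j ∈ BoundedFormula.freeVarFinset θ → j ≤ n := by
    refine ⟨(BoundedFormula.freeVarFinset θ).sup (Sum.elim (fun _ => 0) id), fun j hj => ?_⟩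
    exact Finset.le_sup (f := Sum.elim (fun _ => 0) id) hj
  let g : Fin B ⊕ ℕ → Empty ⊕ Fin (B + (n + 1)) :=
    Sum.elim (fun i => Sum.inr (Fin.castAdd (n+1) i))
      (fun j => Sum.inr (Fin.natAdd B ⟨min j n, by omega⟩))
  refine ⟨n + 1, BoundedFormula.relabel g θ, hθ.relabel g, fun M _ => ?_⟩
  rw [realize_sigma2]
  have key : ∀ (x : Fin B → M) (y : Fin (n+1) → M),
      BoundedFormula.Realize (l := B + (n+1)) (BoundedFormula.relabel g θ) default (Fin.append x y) ↔
        θ.Realize (Sum.elim x (fun j => y ⟨min j n, by omega⟩)) := by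
    intro x y
    refine BoundedFormula.realize_relabel.trans ?_
    unfold Formula.Realize
    rw [iff_eq_eq]
    congr 1
    · funext a
      rcases a with i | j
      · exact Fin.append_left x y i
      · exact Fin.append_right x y _
    · exact Subsingleton.elim _ _
  refine exists_congr fun x => ?_
  constructor
  · intro h y
    have := (key x _).1 (h (fun j => y j))
    refine (realize_congr_free θ _ _ ?_).1 this
    rintro (i | j) ha
    · rfl
    · simp [hn j ha]
  · intro h y
    exact (key x y).2 (h _)

theorem exists_conj {B : ℕ} (s : Finset (L.Formula (Fin B ⊕ ℕ))) (hs : ∀ θ ∈ s, θ.IsQF) :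
    ∃ θ' : L.Formula (Fin B ⊕ ℕ), θ'.IsQF ∧
      ∀ (M : Type max u v) [L.Structure M] (v : Fin B ⊕ ℕ → M),
        θ'.Realize v ↔ ∀ θ ∈ s, θ.Realize v := by
  classical
  induction s using Finset.induction_on with
  | empty => exact ⟨⊤, BoundedFormula.IsQF.top, fun M _ v => by simp⟩
  | insert a s ha ih =>
    obtain ⟨θ', h1, h2⟩ := ih (fun θ h => hs θ (Finset.mem_insert_of_mem h))
    refine ⟨a ⊓ θ', (hs a (Finset.mem_insert_self _ _)).inf h1, fun M _ v => ?_⟩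
    rw [Formula.realize_inf, h2, Finset.forall_mem_insert]

theorem exists_disj {B : ℕ} (s : Finset (L.Formula (Fin B ⊕ ℕ))) (hs : ∀ θ ∈ s, θ.IsQF) :
    ∃ θ' : L.Formula (Fin B ⊕ ℕ), θ'.IsQF ∧
      ∀ (M : Type max u v) [L.Structure M] [Nonempty M] (x : Fin B → M),
        AllF θ' M x ↔ ∃ θ ∈ s, AllF θ M x := by
  classical
  induction s using Finset.induction_on with
  | empty => exact ⟨⊥, BoundedFormula.isQF_bot, fun M _ _ v => by simp [AllF]⟩
  | insert a s ha ih =>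
    obtain ⟨θ', h1, h2⟩ := ih (fun θ h => hs θ (Finset.mem_insert_of_mem h))
    refine ⟨a.relabel (Sum.map id (fun j => 2 * j)) ⊔ θ'.relabel (Sum.map id (fun j => 2 * j + 1)),
      ((hs a (Finset.mem_insert_self _ _)).relabel _).sup (h1.relabel _), fun M _ _ x => ?_⟩
    rw [Finset.exists_mem_insert, ← h2]
    have e : ∀ (y : ℕ → M) (f : ℕ → ℕ), Sum.elim x y ∘ Sum.map id f = Sum.elim x (y ∘ f) := by
      intro y f; funext a; rcases a with i | j <;> rfl
    simp only [AllF, Formula.realize_sup, Formula.realize_relabel, e]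
    constructor
    · intro h
      by_contra hc
      push Not at hc
      obtain ⟨⟨y, hy⟩, z, hz⟩ := hc
      rcases h (fun k => if k % 2 = 0 then y (k / 2) else z (k / 2)) with h | h
      · apply hy
        convert h using 2
        funext j; simp
      · apply hz
        convert h using 2
        funext j
        have e1 : (2 * j + 1) % 2 ≠ 0 := by omega
        have e2 : (2 * j + 1) / 2 = j := by omega
        simp [e2]
    · rintro (h | h) y
      · exact Or.inl (h _)
      · exact Or.inr (h _)

/-- Łoś, packaged. -/
theorem los.{w} {α : Type w} (M : α → Type max u v) [∀ a, L.Structure (M a)]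
    [∀ a, Nonempty (M a)] (U : Ultrafilter α) :
    ∃ (P : Type max w u v) (_ : L.Structure P) (_ : Nonempty P) (mk : (∀ a, M a) → P),
      Function.Surjective mk ∧ (∀ φ : L.Sentence, P ⊨ φ ↔ ∀ᶠ a in U, M a ⊨ φ) ∧
      ∀ (γ : Type) (φ : L.Formula γ) (x : γ → ∀ a, M a),
        φ.Realize (fun i => mk (x i)) ↔ ∀ᶠ a in U, φ.Realize (fun i => x i a) :=
  ⟨(U : Filter α).Product M, inferInstance, inferInstance,
    fun x => (x : (U : Filter α).Product M), Quotient.mk''_surjective,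
    fun φ => Ultraproduct.sentence_realize φ, fun _ φ x => Ultraproduct.realize_formula_cast φ x⟩

theorem lowenheim [Finite L.Symbols] {B : ℕ} (N : Type max u v) [L.Structure N] [Nonempty N]
    (b : Fin B → N) :
    ∃ (S : L.ElementarySubstructure N), Countable S ∧ Nonempty S ∧ ∀ i, b i ∈ S := by
  by_cases hc : Countable N
  · refine ⟨⊤, ?_, ?_, fun i => by simp⟩
    · exact Subtype.countable
    · exact ⟨⟨Classical.arbitrary N, by simp⟩⟩
  · have h4 : Cardinal.aleph0 ≤ Cardinal.mk N := by
      by_contra h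
      push Not at h
      exact hc (Cardinal.mk_le_aleph0_iff.1 h.le)
    obtain ⟨S, h1, h2⟩ := exists_elementarySubstructure_card_eq L (Set.range b)
      (Cardinal.aleph0.{max u v}) le_rfl
      (by simp)
      (by
        rw [Cardinal.lift_id, Cardinal.lift_id]
        exact Cardinal.mk_le_aleph0_iff.2 (Finite.to_countable)) (by simpa using h4)
    have h2 : Cardinal.mk S = Cardinal.aleph0 := by simpa using h2
    refine ⟨S, Cardinal.mk_le_aleph0_iff.1 h2.le, ?_, fun i => h1 ⟨i, rfl⟩⟩
    rw [← Cardinal.mk_ne_zero_iff, h2]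
    exact Cardinal.aleph0_ne_zero

theorem embed {B : ℕ} {N P : Type max u v} [L.Structure N] [L.Structure P]
    (b : Fin B → N) (e : ℕ → N) (he : Function.Surjective e) (a : Fin B → P) (y : ℕ → P)
    (h : ∀ θ : L.Formula (Fin B ⊕ ℕ), θ.IsQF → θ.Realize (Sum.elim b e) →
      θ.Realize (Sum.elim a y)) :
    ∃ g : N ↪[L] P, ∀ i, g (b i) = a i := by
  obtain ⟨r, hr⟩ := he.hasRightInverse
  have h' : ∀ θ : L.Formula (Fin B ⊕ ℕ), θ.IsQF → (θ.Realize (Sum.elim b e) ↔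
      θ.Realize (Sum.elim a y)) := by
    intro θ hθ
    refine ⟨h θ hθ, fun h1 => ?_⟩
    by_contra h2
    have := h θ.not hθ.not (by rwa [Formula.realize_not])
    rw [Formula.realize_not] at this
    exact this h1
  have heq : ∀ s t : L.Term (Fin B ⊕ ℕ), s.realize (Sum.elim b e) = t.realize (Sum.elim b e) ↔
      s.realize (Sum.elim a y) = t.realize (Sum.elim a y) := by
    intro s t
    have := h' (s.equal t) (BoundedFormula.IsAtomic.equal _ _).isQF
    simpa only [Formula.realize_equal] using this
  let var' : ℕ → L.Term (Fin B ⊕ ℕ) := fun j => Term.var (Sum.inr j)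
  refine ⟨⟨⟨fun z => y (r z), ?_⟩, ?_, ?_⟩, ?_⟩
  · intro z w hzw
    have := (heq (var' (r z)) (var' (r w))).2 (by simpa [var'] using hzw)
    simpa [var', hr z, hr w] using this
  · intro n f x
    have := (heq (var' (r (Structure.funMap f x))) (Term.func f (fun i => var' (r (x i))))).1
      (by simp [var', hr _])
    simp only [var', Term.realize_var, Sum.elim_inr, Term.realize_func] at this
    exact this
  · intro n R x
    have := h' (R.formula (fun i => var' (r (x i)))) (BoundedFormula.IsAtomic.rel _ _).isQF
    rw [Formula.realize_rel, Formula.realize_rel] at this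
    simp only [var', Term.realize_var, Sum.elim_inr, hr _] at this
    exact this.symm
  · intro i
    have := (heq (var' (r (b i))) (Term.var (Sum.inl i))).1 (by simp [var', hr _])
    simp only [var', Term.realize_var, Sum.elim_inr, Sum.elim_inl] at this
    exact this

theorem main_claim [Finite L.Symbols] (φ : L.Sentence) (B : ℕ) (hφ : PSC φ B)
    (M : Type max u v) [L.Structure M] [Nonempty M] (hM : M ⊨ φ) :
    ∃ θ : L.Formula (Fin B ⊕ ℕ), θ.IsQF ∧ (∃ x, AllF θ M x) ∧
      ∀ (M' : Type max u v) [L.Structure M'] [Nonempty M'] (x : Fin B → M'),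
        AllF θ M' x → M' ⊨ φ := by
  classical
  by_contra hcon
  push Not at hcon
  -- the ultrapower
  obtain ⟨P, iP, nP, mk, mks, los1, los2⟩ := los (L := L) (fun _ : ℕ => M) (Filter.hyperfilter ℕ)
  have hP : P ⊨ φ := (los1 φ).2 (Filter.Eventually.of_forall fun _ => hM)
  obtain ⟨C, hCB, hC⟩ := hφ P hP
  -- core as a tuple
  obtain ⟨a, ha⟩ : ∃ a : Fin B → P, ∀ c ∈ C, ∃ i, a i = c := by
    refine ⟨fun i => if h : (i : ℕ) < C.card then (C.equivFin.symm ⟨i, h⟩ : P)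
      else Classical.arbitrary P, fun c hc => ?_⟩
    refine ⟨⟨C.equivFin ⟨c, hc⟩, (C.equivFin ⟨c, hc⟩).2.trans_le hCB⟩, ?_⟩
    simp
  choose a' ha' using fun i => mks (a i)
  obtain rfl : (fun i => mk (a' i)) = a := funext ha'
  have losP : ∀ (θ : L.Formula (Fin B ⊕ ℕ)) (y : ℕ → ℕ → M),
      θ.Realize (Sum.elim (fun i => mk (a' i)) (fun j => mk (y j))) ↔
      ∀ᶠ k in (Filter.hyperfilter ℕ : Filter ℕ),
        θ.Realize (Sum.elim (fun i => a' i k) (fun j => y j k)) := by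
    intro θ y
    have := los2 _ θ (Sum.elim a' y)
    convert this using 2
    · funext z; rcases z with i | j <;> rfl
    · funext k
      congr 1; funext z; rcases z with i | j <;> rfl
  -- a model of the negation satisfying the universal type
  have step : ∃ (N : Type max u v) (_ : L.Structure N) (_ : Nonempty N) (b : Fin B → N),
      ¬ (N ⊨ φ) ∧ ∀ θ : L.Formula (Fin B ⊕ ℕ), θ.IsQF → AllF θ P (fun i => mk (a' i)) →
        AllF θ N b := by
    let T := {θ : L.Formula (Fin B ⊕ ℕ) // θ.IsQF ∧ AllF θ P (fun i => mk (a' i))}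
    have fin : ∀ s : Finset T, ∃ (N : Type max u v) (_ : L.Structure N) (_ : Nonempty N)
        (b : Fin B → N), ¬ (N ⊨ φ) ∧ ∀ θ ∈ s, AllF θ.1 N b := by
      intro s
      obtain ⟨θ', q, hθ'⟩ := exists_conj (s.image Subtype.val) (by
        intro θ hθ
        obtain ⟨t, _, rfl⟩ := Finset.mem_image.1 hθ
        exact t.2.1)
      have hMx : ∃ x, AllF θ' M x := by
        by_contra hno
        push Not at hno
        have : ∀ k, ∃ y : ℕ → M, ¬ θ'.Realize (Sum.elim (fun i => a' i k) y) := by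
          intro k
          have := hno (fun i => a' i k)
          simpa [AllF] using this
        choose y hy using this
        have h1 : θ'.Realize (Sum.elim (fun i => mk (a' i)) (fun j => mk (fun k => y k j))) := by
          rw [hθ']
          intro θ hθ
          obtain ⟨t, _, rfl⟩ := Finset.mem_image.1 hθ
          exact t.2.2 _
        rw [losP] at h1
        obtain ⟨k, hk⟩ := h1.exists
        exact hy k hk
      obtain ⟨N, iN, nN, b, h1, h2⟩ := hcon θ' q hMx
      refine ⟨N, iN, nN, b, h2, fun t ht y => ?_⟩
      exact (hθ' N _).1 (h1 y) t.1 (Finset.mem_image_of_mem _ ht)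
    choose N iN nN b h1 h2 using fin
    obtain ⟨Q, iQ, nQ, mq, mqs, q1, q2⟩ := los (L := L) N (Ultrafilter.of Filter.atTop)
    refine ⟨Q, iQ, nQ, fun i => mq (fun s => b s i), ?_, ?_⟩
    · rw [q1]
      intro h
      obtain ⟨s, hs⟩ := h.exists
      exact h1 s hs
    · intro θ q hθ y
      choose y' hy' using fun j => mqs (y j)
      obtain rfl : (fun j => mq (y' j)) = y := funext hy'
      have := q2 _ θ (Sum.elim (fun i s => b s i) y')
      have h3 : ∀ᶠ s in (Ultrafilter.of (Filter.atTop : Filter (Finset T)) : Filter (Finset T)),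
          θ.Realize (fun i => (Sum.elim (fun i s => b s i) y' : Fin B ⊕ ℕ → ∀ s, N s) i s) := by
        apply Ultrafilter.of_le
        filter_upwards [Filter.eventually_ge_atTop ({⟨θ, q, hθ⟩} : Finset T)] with s hs
        have h4 := h2 s ⟨θ, q, hθ⟩ (hs (Finset.mem_singleton_self _)) (fun j => y' j s)
        convert h4 using 1
        funext z; rcases z with i | j <;> rfl
      have h5 := this.2 h3
      convert h5 using 1
      funext z; rcases z with i | j <;> rfl
  -- countable
  have step2 : ∃ (N : Type max u v) (_ : L.Structure N) (_ : Nonempty N) (_ : Countable N)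
      (b : Fin B → N), ¬ (N ⊨ φ) ∧ ∀ θ : L.Formula (Fin B ⊕ ℕ), θ.IsQF →
        AllF θ P (fun i => mk (a' i)) → AllF θ N b := by
    obtain ⟨N, iN, nN, b, h1, h2⟩ := step
    obtain ⟨S, c, ne, hb⟩ := lowenheim (L := L) N b
    refine ⟨S, inferInstance, ne, c, fun i => ⟨b i, hb i⟩, ?_, ?_⟩
    · rwa [ElementarySubstructure.realize_sentence]
    · intro θ q hθ y
      have := h2 θ q hθ (fun j => (y j : N))
      rw [← ElementaryEmbedding.map_formula S.subtype]
      convert this using 1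
      funext z; rcases z with i | j <;> rfl
  obtain ⟨N, iN, nN, cN, b, hN, hT⟩ := step2
  obtain ⟨e, he⟩ := exists_surjective_nat N
  have cF : Countable (L.Formula (Fin B ⊕ ℕ)) := inferInstance
  have : Nonempty (L.Formula (Fin B ⊕ ℕ)) := ⟨⊥⟩
  obtain ⟨t, ht⟩ := exists_surjective_nat (L.Formula (Fin B ⊕ ℕ))
  let s : ℕ → Finset (L.Formula (Fin B ⊕ ℕ)) := fun k =>
    ((Finset.range k).image t).filter (fun θ => θ.IsQF ∧ θ.Realize (Sum.elim b e))
  let D : ℕ → ℕ → Prop := fun i k =>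
    ∃ y : ℕ → M, ∀ θ ∈ s k, θ.Realize (Sum.elim (fun l => a' l i) y)
  have D0 : ∀ i, D i 0 := fun i => ⟨fun _ => Classical.arbitrary M, by simp [s]⟩
  have DK : ∀ i, D i (Nat.findGreatest (D i) i) := fun i =>
    Nat.findGreatest_spec (Nat.zero_le i) (D0 i)
  choose w hw using DK
  have Dev : ∀ k, ∀ᶠ i in (Filter.hyperfilter ℕ : Filter ℕ), D i k := by
    intro k
    obtain ⟨θ', q, hθ'⟩ := exists_conj (s k) (fun θ hθ => (Finset.mem_filter.1 hθ).2.1)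
    have h1 : ¬ AllF θ'.not P (fun i => mk (a' i)) := by
      intro h
      have h2 := hT θ'.not q.not h e
      rw [Formula.realize_not, hθ'] at h2
      exact h2 (fun θ hθ => (Finset.mem_filter.1 hθ).2.2)
    unfold AllF at h1
    push Not at h1
    obtain ⟨y, hy⟩ := h1
    rw [Formula.realize_not, not_not] at hy
    choose y' hy' using fun j => mks (y j)
    obtain rfl : (fun j => mk (y' j)) = y := funext hy'
    rw [losP] at hy
    filter_upwards [hy] with i hi
    exact ⟨_, (hθ' M _).1 hi⟩
  obtain ⟨g, hg⟩ := embed b e he (fun i => mk (a' i)) (fun j => mk (fun i => w i j)) (by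
    intro θ q hθ
    obtain ⟨k, rfl⟩ := ht θ
    rw [losP]
    have hge : ∀ᶠ i in (Filter.hyperfilter ℕ : Filter ℕ), k + 1 ≤ i := by
      apply Nat.hyperfilter_le_atTop
      exact Filter.eventually_ge_atTop _
    filter_upwards [Dev (k + 1), hge] with i h1 h2
    refine hw i (t k) ?_
    have h3 : k + 1 ≤ Nat.findGreatest (D i) i := Nat.le_findGreatest h2 h1
    refine Finset.mem_filter.2 ⟨Finset.mem_image_of_mem _ (Finset.mem_range.2 (by omega)), q, hθ⟩)
  apply hN
  rw [StrongHomClass.realize_sentence g.equivRange]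
  refine hC _ ?_ ⟨g.equivRange (Classical.arbitrary N)⟩
  intro c hc
  obtain ⟨i, rfl⟩ := ha c hc
  exact ⟨b i, hg i⟩

theorem forward [Finite L.Symbols] (φ : L.Sentence) (B : ℕ) (hφ : PSC φ B) :
    ∃ (n : ℕ) (β : L.BoundedFormula Empty (B + n)), β.IsQF ∧ Equiv φ (sigma2 B n β) := by
  classical
  let T := {θ : L.Formula (Fin B ⊕ ℕ) // θ.IsQF ∧
      ∀ (M' : Type max u v) [L.Structure M'] [Nonempty M'] (x : Fin B → M'),
        AllF θ M' x → M' ⊨ φ}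
  have key : ∃ s : Finset T, ∀ (M : Type max u v) [L.Structure M] [Nonempty M], M ⊨ φ →
      ∃ θ ∈ s, ∃ x, AllF θ.1 M x := by
    by_contra hcon
    push Not at hcon
    choose N iN nN h1 h2 using hcon
    obtain ⟨Q, iQ, nQ, mq, mqs, q1, q2⟩ := los (L := L) N (Ultrafilter.of Filter.atTop)
    obtain ⟨θ, q, ⟨x, hx⟩, hθ⟩ := main_claim φ B hφ Q
      ((q1 φ).2 (Filter.Eventually.of_forall h1))
    choose x' hx' using fun j => mqs (x j)
    obtain rfl : (fun j => mq (x' j)) = x := funext hx'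
    have : ∀ s : Finset T, ∃ y : ℕ → N s, (⟨θ, q, hθ⟩ : T) ∈ s →
        ¬ θ.Realize (Sum.elim (fun i => x' i s) y) := by
      intro s
      by_cases hs : (⟨θ, q, hθ⟩ : T) ∈ s
      · have := h2 s _ hs (fun i => x' i s)
        unfold AllF at this
        push Not at this
        obtain ⟨y, hy⟩ := this
        exact ⟨y, fun _ => hy⟩
      · exact ⟨fun _ => Classical.arbitrary _, fun h => absurd h hs⟩
    choose y hy using this
    have h3 := hx (fun j => mq (fun s => y s j))
    have h4 := (q2 _ θ (Sum.elim x' (fun j s => y s j))).1 (by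
      convert h3 using 1
      funext z; rcases z with i | j <;> rfl)
    have h5 : ∀ᶠ s in (Ultrafilter.of (Filter.atTop : Filter (Finset T)) : Filter (Finset T)),
        (⟨θ, q, hθ⟩ : T) ∈ s := by
      apply Ultrafilter.of_le
      filter_upwards [Filter.eventually_ge_atTop ({⟨θ, q, hθ⟩} : Finset T)] with s hs
      exact hs (Finset.mem_singleton_self _)
    obtain ⟨s, hs1, hs2⟩ := (h4.and h5).exists
    apply hy s hs2
    convert hs1 using 1
    funext z; rcases z with i | j <;> rfl
  obtain ⟨s, hs⟩ := key
  obtain ⟨θ', q, hθ'⟩ := exists_disj (s.image Subtype.val) (by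
    intro θ hθ
    obtain ⟨t, _, rfl⟩ := Finset.mem_image.1 hθ
    exact t.2.1)
  obtain ⟨n, β, qβ, hβ⟩ := exists_sigma2 θ' q
  refine ⟨n, β, qβ, fun M _ _ => ?_⟩
  rw [hβ]
  constructor
  · intro h
    obtain ⟨θ, h1, x, hx⟩ := hs M h
    exact ⟨x, (hθ' M x).2 ⟨θ.1, Finset.mem_image_of_mem _ h1, hx⟩⟩
  · rintro ⟨x, hx⟩
    obtain ⟨θ, h1, h2⟩ := (hθ' M x).1 hx
    obtain ⟨t, _, rfl⟩ := Finset.mem_image.1 h1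
    exact t.2.2 M x h2

theorem backward (φ : L.Sentence) (B n : ℕ) (β : L.BoundedFormula Empty (B + n)) (q : β.IsQF)
    (h : Equiv φ (sigma2 B n β)) : PSC φ B := by
  classical
  intro M _ _ hM
  obtain ⟨x, hx⟩ := (realize_sigma2 B n β).1 ((h M).1 hM)
  refine ⟨Finset.univ.image x, Finset.card_image_le.trans (by simp), fun N hN ne => ?_⟩
  rw [h N, realize_sigma2]
  have hxN : ∀ i, x i ∈ N := fun i => hN (by simp)
  refine ⟨fun i => ⟨x i, hxN i⟩, fun y => ?_⟩
  rw [← q.realize_embedding N.subtype]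
  convert hx (fun j => (y j : M)) using 1
  · funext k
    refine Fin.addCases (fun i => ?_) (fun j => ?_) k <;> simp

end Helpers

/-- For every `B ∈ ℕ`, an FO sentence `φ` over a finite vocabulary is in `PSC(B)` iff `φ` is
logically equivalent to a Σ⁰₂ sentence `∃x₁…x_B ∀y₁…y_n β` with exactly `B` existential
quantifiers (`β` quantifier-free). -/
theorem statement2 [Finite L.Symbols] (φ : L.Sentence) (B : ℕ) :
    PSC φ B ↔
      ∃ (n : ℕ) (β : L.BoundedFormula Empty (B + n)), β.IsQF ∧ Equiv φ (sigma2 B n β) := by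
  exact ⟨forward φ B, fun ⟨n, β, q, h⟩ => backward φ B n β q h⟩

end Stmt
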